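/- Let f : S¹ → S¹ be a homeomorphism of the unit circle with f(1) = 1, and let F = F(f) : 𝔻 → 𝔻 be its radial mollified extension. Then F is a homeomorphism of the closed unit disc onto itself, and F preserves nullity: for every A ⊆ 𝔻, A has Lebesgue measure zero if and only if F(A) has Lebesgue measure zero. -/

import Mathlib

open Metric MeasureTheory

noncomputable section

/-- The closed unit disc in `ℂ`. -/
def unitDisc : Set ℂ := Metric.closedBall 0 1

/-- The unit circle in `ℂ`. -/
def unitCircle : Set ℂ := Metric.sphere 0 1

/-- The normalization constant `c = ∫_{-1}^{1} exp(-1/(1-x²)) dx`. -/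
def bumpC : ℝ := ∫ x in (-1 : ℝ)..1, Real.exp (-1 / (1 - x ^ 2))

/-- The normalized smooth bump `β_ε` supported on `[-ε, ε]`. -/
def bump (ε x : ℝ) : ℝ :=
  if |x| < ε then (1 / (bumpC * ε)) * Real.exp (-1 / (1 - (x / ε) ^ 2)) else 0

/-- The convolution `(β_ε * g)(θ) = ∫ β_ε(x) g(θ - x) dx`. -/
def bumpConv (ε : ℝ) (g : ℝ → ℝ) (θ : ℝ) : ℝ := ∫ x : ℝ, bump ε x * g (θ - x)

/-- `f` restricts to a homeomorphism of the unit circle (a continuous bijection of the compact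
circle onto itself). -/
def CircleHomeo (f : ℂ → ℂ) : Prop :=
  ContinuousOn f unitCircle ∧ Set.BijOn f unitCircle unitCircle

/-- `g` is the continuous lift of `f` with `f (e^{iθ}) = e^{i g θ}` and `g 0 = 0`. -/
def IsLift (f : ℂ → ℂ) (g : ℝ → ℝ) : Prop :=
  Continuous g ∧ g 0 = 0 ∧
    ∀ θ : ℝ, f (Complex.exp (θ * Complex.I)) = Complex.exp (g θ * Complex.I)

/-- The radial mollified extension `F(f)` of a circle homeomorphism `f` with lift `g`:
`F(0) = 0`, `F(r e^{iθ}) = r e^{i (β_{1-r} * g)(θ)}` for `0 < r < 1`, and `F = f` on the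
circle. -/
def radExt (f : ℂ → ℂ) (g : ℝ → ℝ) (z : ℂ) : ℂ :=
  if ‖z‖ = 1 then f z
  else (‖z‖ : ℂ) *
    Complex.exp ((bumpConv (1 - ‖z‖) g (Complex.arg z) : ℝ) * Complex.I)

lemma exp_eq_expNegInvGlue {y : ℝ} (hy : 0 < y) : Real.exp (-1 / y) = expNegInvGlue y := by
  rw [expNegInvGlue, if_neg (not_le.2 hy), neg_div, one_div]

lemma one_sub_div_sq_pos_iff {ε x : ℝ} (hε : 0 < ε) : 0 < 1 - (x / ε) ^ 2 ↔ |x| < ε := by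
  rw [sub_pos, sq_lt_one_iff_abs_lt_one, abs_div, abs_of_pos hε, div_lt_one hε]

lemma continuous_expNegInvGlue : Continuous expNegInvGlue :=
  (expNegInvGlue.contDiff (n := 0)).continuous

lemma hasDerivAt_expNegInvGlue (x : ℝ) :
    HasDerivAt expNegInvGlue (x⁻¹ ^ 2 * expNegInvGlue x) x := by
  simpa using expNegInvGlue.hasDerivAt_polynomial_eval_inv_mul 1 x

lemma bumpC_eq_integral : bumpC = ∫ x : ℝ, expNegInvGlue (1 - x ^ 2) := by
  have h : ∀ x ∉ Set.Ioo (-1 : ℝ) 1, expNegInvGlue (1 - x ^ 2) = 0 := by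
    intro x hx
    refine expNegInvGlue.zero_of_nonpos ?_
    by_contra! h
    exact hx ⟨by nlinarith, by nlinarith⟩
  rw [bumpC, intervalIntegral.integral_of_le (by norm_num), integral_Ioc_eq_integral_Ioo,
    ← setIntegral_eq_integral_of_forall_compl_eq_zero h]
  refine setIntegral_congr_fun measurableSet_Ioo fun x hx => exp_eq_expNegInvGlue ?_
  nlinarith [hx.1, hx.2]

lemma bumpC_pos : 0 < bumpC := by
  rw [bumpC_eq_integral]
  refine Continuous.integral_pos_of_hasCompactSupport_nonneg_nonzero (x := 0)
    (continuous_expNegInvGlue.comp (by fun_prop)) ?_ (fun x => expNegInvGlue.nonneg _) ?_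
  · refine HasCompactSupport.intro (isCompact_Icc (a := (-1 : ℝ)) (b := 1)) fun x hx => ?_
    refine expNegInvGlue.zero_of_nonpos ?_
    by_contra! h
    exact hx ⟨by nlinarith, by nlinarith⟩
  · exact (expNegInvGlue.pos_of_pos (by norm_num)).ne'

lemma bump_eq {ε : ℝ} (hε : 0 < ε) (x : ℝ) :
    bump ε x = (bumpC * ε)⁻¹ * expNegInvGlue (1 - (x / ε) ^ 2) := by
  unfold bump
  split_ifs with h
  · rw [one_div, exp_eq_expNegInvGlue ((one_sub_div_sq_pos_iff hε).2 h)]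
  · rw [expNegInvGlue.zero_of_nonpos, mul_zero]
    exact not_lt.1 fun h' => h ((one_sub_div_sq_pos_iff hε).1 h')

lemma bump_eq_zero {ε x : ℝ} (h : ε ≤ |x|) : bump ε x = 0 := if_neg (not_lt.2 h)

lemma bump_nonneg {ε : ℝ} (hε : 0 < ε) (x : ℝ) : 0 ≤ bump ε x := by
  rw [bump_eq hε]
  have := bumpC_pos
  have := expNegInvGlue.nonneg (1 - (x / ε) ^ 2)
  positivity

lemma contDiff_bump {ε : ℝ} (hε : 0 < ε) {n : ℕ∞} : ContDiff ℝ n (bump ε) := by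
  rw [funext (bump_eq hε)]
  exact contDiff_const.mul (expNegInvGlue.contDiff.comp (by fun_prop))

lemma hasCompactSupport_bump (ε : ℝ) : HasCompactSupport (bump ε) := by
  refine HasCompactSupport.intro (isCompact_Icc (a := -ε) (b := ε)) fun x hx => bump_eq_zero ?_
  by_contra! h
  exact hx ⟨(abs_lt.1 h).1.le, (abs_lt.1 h).2.le⟩

lemma integral_bump_one : ∫ x, bump 1 x = 1 := by
  simp_rw [bump_eq one_pos, div_one, mul_one]
  rw [integral_const_mul, ← bumpC_eq_integral, inv_mul_cancel₀ bumpC_pos.ne']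

/-- The even weight `w` such that `β_ε` has derivative `-x w(x)` at `x`. -/
def bumpWeight (ε x : ℝ) : ℝ :=
  (bumpC * ε)⁻¹ * ((1 - (x / ε) ^ 2)⁻¹ ^ 2 * expNegInvGlue (1 - (x / ε) ^ 2)) * (2 / ε ^ 2)

lemma bumpWeight_neg (ε x : ℝ) : bumpWeight ε (-x) = bumpWeight ε x := by
  simp [bumpWeight, neg_div]

lemma bumpWeight_nonneg {ε : ℝ} (hε : 0 < ε) (x : ℝ) : 0 ≤ bumpWeight ε x := by
  have := bumpC_pos
  have := expNegInvGlue.nonneg (1 - (x / ε) ^ 2)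
  unfold bumpWeight
  positivity

lemma bumpWeight_pos {ε x : ℝ} (hε : 0 < ε) (hx : |x| < ε) : 0 < bumpWeight ε x := by
  have := bumpC_pos
  have h := (one_sub_div_sq_pos_iff hε).2 hx
  have := expNegInvGlue.pos_of_pos h
  unfold bumpWeight
  positivity

lemma deriv_bump {ε : ℝ} (hε : 0 < ε) (x : ℝ) : deriv (bump ε) x = -(x * bumpWeight ε x) := by
  rw [funext (bump_eq hε)]
  have h : HasDerivAt (fun x : ℝ => 1 - (x / ε) ^ 2) (-(x * (2 / ε ^ 2))) x := by
    convert! (((hasDerivAt_id x).div_const ε).pow 2).const_sub 1 using 1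
    simp
    field_simp
  refine (((hasDerivAt_expNegInvGlue _).comp x h).const_mul _).deriv.trans ?_
  unfold bumpWeight
  ring

/-- Differentiating the mollification of a strictly increasing function and folding the integral
by the oddness of the derivative of `β_ε` gives a positive derivative. -/
lemma exists_hasDerivAt_bumpConv_pos {g : ℝ → ℝ} (hg : Continuous g) (hmono : StrictMono g)
    {ε : ℝ} (hε : 0 < ε) (θ : ℝ) : ∃ d, 0 < d ∧ HasDerivAt (bumpConv ε g) d θ := by
  refine ⟨_, ?_, (hasCompactSupport_bump ε).hasDerivAt_convolution_left
    (ContinuousLinearMap.lsmul ℝ ℝ) (contDiff_bump hε (n := 1)) hg.locallyIntegrable θ⟩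
  have hc : Continuous (deriv (bump ε)) := (contDiff_bump hε (n := 1)).continuous_deriv le_rfl
  have hs : HasCompactSupport (deriv (bump ε)) := (hasCompactSupport_bump ε).deriv
  change 0 < ∫ t, deriv (bump ε) t * g (θ - t)
  have hint : ∀ h : ℝ → ℝ, Continuous h → Integrable fun t => deriv (bump ε) t * h t :=
    fun h hh => (hc.mul hh).integrable_of_hasCompactSupport hs.mul_right
  have hflip : ∫ t, deriv (bump ε) t * g (θ - t) = -∫ t, deriv (bump ε) t * g (θ + t) := by
    rw [← integral_neg_eq_self, ← integral_neg]
    congr 1 with t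
    rw [deriv_bump hε, deriv_bump hε, bumpWeight_neg, sub_neg_eq_add]
    ring
  have hpos : 0 < ∫ t, deriv (bump ε) t * (g (θ - t) - g (θ + t)) := by
    refine Continuous.integral_pos_of_hasCompactSupport_nonneg_nonzero (x := ε / 2)
      (by fun_prop) hs.mul_right (fun t => ?_) ?_
    · simp only [Pi.zero_apply, deriv_bump hε]
      have hw := bumpWeight_nonneg hε t
      rcases le_total 0 t with ht | ht
      · have : g (θ - t) ≤ g (θ + t) := hmono.monotone (by linarith)
        nlinarith [mul_nonneg ht hw]
      · have : g (θ + t) ≤ g (θ - t) := hmono.monotone (by linarith)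
        nlinarith [mul_nonneg (neg_nonneg.2 ht) hw]
    · rw [deriv_bump hε]
      have hw := bumpWeight_pos (x := ε / 2) hε (by rw [abs_of_pos] <;> linarith)
      have : g (θ - ε / 2) < g (θ + ε / 2) := hmono (by linarith)
      exact mul_ne_zero (neg_ne_zero.2 (by positivity)) (sub_ne_zero.2 this.ne)
  simp_rw [mul_sub] at hpos
  rw [integral_sub (hint _ (by fun_prop)) (hint _ (by fun_prop))] at hpos
  linarith

lemma differentiableAt_bumpConv {g : ℝ → ℝ} (hg : Continuous g) {p : ℝ × ℝ} (hp : 0 < p.1) :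
    DifferentiableAt ℝ (fun q : ℝ × ℝ => bumpConv q.1 g q.2) p := by
  have hopen : IsOpen (Set.Ioo 0 (p.1 + 1)) := isOpen_Ioo
  have hcd : ContDiffOn ℝ ((1 : ℕ∞) : WithTop ℕ∞)
      (fun q : ℝ × ℝ => convolution (bump q.1) g (ContinuousLinearMap.lsmul ℝ ℝ) volume q.2)
      (Set.Ioo 0 (p.1 + 1) ×ˢ Set.univ) := by
    refine contDiffOn_convolution_left_with_param _ hopen
      (isCompact_Icc (a := -(p.1 + 1)) (b := p.1 + 1)) ?_ hg.locallyIntegrable ?_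
    · intro ε x hε hx
      refine bump_eq_zero ?_
      by_contra! h
      exact hx ⟨by linarith [(abs_lt.1 h).1, hε.2], by linarith [(abs_lt.1 h).2, hε.2]⟩
    · have : ContDiffOn ℝ ((1 : ℕ∞) : WithTop ℕ∞) (fun q : ℝ × ℝ =>
          (bumpC * q.1)⁻¹ * expNegInvGlue (1 - (q.2 / q.1) ^ 2))
          (Set.Ioo 0 (p.1 + 1) ×ˢ Set.univ) := by
        refine ContDiffOn.mul (ContDiffOn.inv (by fun_prop) fun q hq => ?_)
          (expNegInvGlue.contDiff.comp_contDiffOn ?_)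
        · exact mul_ne_zero bumpC_pos.ne' hq.1.1.ne'
        · exact contDiffOn_const.sub
            ((contDiffOn_snd.div contDiffOn_fst fun q hq => hq.1.1.ne').pow 2)
      exact this.congr fun q hq => bump_eq hq.1.1 q.2
  refine (hcd.differentiableOn (by norm_num)).differentiableAt ?_
  exact (hopen.prod isOpen_univ).mem_nhds ⟨⟨hp, by linarith⟩, trivial⟩

/-- The mollification after rescaling, which also makes sense at `ε = 0`. -/
def mollify (g : ℝ → ℝ) (ε θ : ℝ) : ℝ := ∫ u, bump 1 u * g (θ - ε * u)

lemma bumpConv_eq_mollify (g : ℝ → ℝ) {ε : ℝ} (hε : 0 < ε) (θ : ℝ) :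
    bumpConv ε g θ = mollify g ε θ := by
  have h := Measure.integral_comp_mul_left (fun x => bump ε x * g (θ - x)) ε
  rw [abs_of_pos (inv_pos.2 hε), smul_eq_mul] at h
  have h' : ∀ u, bump ε (ε * u) * g (θ - ε * u) = ε⁻¹ * (bump 1 u * g (θ - ε * u)) := by
    intro u
    rw [bump_eq hε, bump_eq one_pos, mul_div_cancel_left₀ _ hε.ne', mul_one, mul_inv, div_one]
    ring
  simp_rw [h', integral_const_mul] at h
  exact (mul_left_cancel₀ (inv_ne_zero hε.ne') h).symm

lemma mollify_zero (g : ℝ → ℝ) (θ : ℝ) : mollify g 0 θ = g θ := by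
  simp [mollify, integral_mul_const, integral_bump_one]

lemma continuous_bump_one : Continuous (bump 1) := (contDiff_bump one_pos (n := 0)).continuous

lemma continuous_mollify {g : ℝ → ℝ} (hg : Continuous g) :
    Continuous fun p : ℝ × ℝ => mollify g p.1 p.2 := by
  have h : ∀ p : ℝ × ℝ, ∫ u in Set.Icc (-1 : ℝ) 1, bump 1 u * g (p.2 - p.1 * u) =
      mollify g p.1 p.2 := by
    refine fun p => setIntegral_eq_integral_of_forall_compl_eq_zero fun u hu => ?_
    rw [bump_eq_zero, zero_mul]
    by_contra! h
    exact hu ⟨(abs_lt.1 h).1.le, (abs_lt.1 h).2.le⟩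
  simp_rw [← h]
  have := continuous_bump_one
  exact continuous_parametric_integral_of_continuous (by fun_prop) isCompact_Icc

lemma integrable_mollify {g : ℝ → ℝ} (hg : Continuous g) (ε θ : ℝ) :
    Integrable fun u => bump 1 u * g (θ - ε * u) :=
  (continuous_bump_one.mul (by fun_prop)).integrable_of_hasCompactSupport
    (hasCompactSupport_bump 1).mul_right

lemma strictMono_mollify {g : ℝ → ℝ} (hg : Continuous g) (hmono : StrictMono g) (ε : ℝ) :
    StrictMono (mollify g ε) := by
  intro a b hab
  have := continuous_bump_one
  rw [← sub_pos, mollify, mollify, ← integral_sub (integrable_mollify hg ε b)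
    (integrable_mollify hg ε a)]
  simp_rw [← mul_sub]
  refine Continuous.integral_pos_of_hasCompactSupport_nonneg_nonzero (x := 0)
      (by fun_prop) (hasCompactSupport_bump 1).mul_right (fun u => ?_) ?_
  · exact mul_nonneg (bump_nonneg one_pos u) (sub_nonneg.2 (hmono.monotone (by linarith)))
  · refine mul_ne_zero ?_ (sub_ne_zero.2 (hmono (by linarith)).ne')
    rw [bump_eq one_pos]
    exact mul_ne_zero (inv_ne_zero (by simpa using bumpC_pos.ne'))
      (expNegInvGlue.pos_of_pos (by norm_num)).ne'

lemma mollify_add_two_pi {g : ℝ → ℝ} (hg : Continuous g)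
    (hper : ∀ θ, g (θ + 2 * Real.pi) = g θ + 2 * Real.pi) (ε θ : ℝ) :
    mollify g ε (θ + 2 * Real.pi) = mollify g ε θ + 2 * Real.pi := by
  have h : ∀ u, bump 1 u * g (θ + 2 * Real.pi - ε * u) =
      bump 1 u * g (θ - ε * u) + bump 1 u * (2 * Real.pi) := fun u => by
    rw [add_sub_right_comm, hper, mul_add]
  simp_rw [mollify, h]
  rw [integral_add (integrable_mollify hg ε θ), integral_mul_const, integral_bump_one, one_mul]
  exact (continuous_bump_one.integrable_of_hasCompactSupport (hasCompactSupport_bump 1)).mul_const _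

lemma measure_eq_zero_iff_image_of_det_ne_zero {E : Type*} [NormedAddCommGroup E]
    [NormedSpace ℝ E] [FiniteDimensional ℝ E] [MeasurableSpace E] [BorelSpace E] (μ : Measure E)
    [μ.IsAddHaarMeasure] {Φ : E → E} {Φ' : E → E →L[ℝ] E} {D S : Set E} (hD : MeasurableSet D)
    (hinj : Set.InjOn Φ D) (hΦ : ∀ x ∈ D, HasFDerivAt Φ (Φ' x) x)
    (hdet : ∀ x ∈ D, (Φ' x).det ≠ 0) (hS : S ⊆ D) : μ S = 0 ↔ μ (Φ '' S) = 0 := by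
  refine ⟨fun h => addHaar_image_eq_zero_of_differentiableOn_of_addHaar_eq_zero μ
    (fun x hx => (hΦ x (hS hx)).differentiableAt.differentiableWithinAt) h, fun h => ?_⟩
  obtain ⟨T, hST, hT, hT0⟩ := exists_measurable_superset_of_null h
  have hcont : ContinuousOn Φ D := fun x hx => (hΦ x hx).continuousAt.continuousWithinAt
  have hM : MeasurableSet (D ∩ Φ ⁻¹' T) := by
    rw [← Subtype.image_preimage_coe]
    exact hD.subtype_image ((continuousOn_iff_continuous_domRestrict.1 hcont).measurable hT)
  have hint := lintegral_abs_det_fderiv_eq_addHaar_image μ hM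
    (fun x hx => (hΦ x hx.1).hasFDerivWithinAt) (hinj.mono Set.inter_subset_left)
  have himage : Φ '' (D ∩ Φ ⁻¹' T) ⊆ T := Set.image_subset_iff.2 Set.inter_subset_right
  rw [measure_mono_null himage hT0, lintegral_eq_zero_iff' (aemeasurable_ofReal_abs_det_fderivWithin
    μ hM fun x hx => (hΦ x hx.1).hasFDerivWithinAt), Filter.EventuallyEq,
    ae_restrict_iff' hM] at hint
  have hsub : S ⊆ {x | ¬(x ∈ D ∩ Φ ⁻¹' T → ENNReal.ofReal |(Φ' x).det| = 0)} := by
    intro x hx h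
    exact hdet x (hS hx) (by simpa using h ⟨hS hx, hST ⟨x, hx, rfl⟩⟩)
  exact measure_mono_null hsub hint

/-- The point with polar coordinates `(r, θ)`. -/
def polarMap (p : ℝ × ℝ) : ℂ := (p.1 : ℂ) * Complex.exp (p.2 * Complex.I)

lemma continuous_polarMap : Continuous polarMap := by
  unfold polarMap
  fun_prop

lemma norm_polarMap {p : ℝ × ℝ} (hp : 0 ≤ p.1) : ‖polarMap p‖ = p.1 := by
  simp [polarMap, Complex.norm_exp_ofReal_mul_I, abs_of_nonneg hp]

lemma polarMap_norm_arg (z : ℂ) : polarMap (‖z‖, Complex.arg z) = z :=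
  Complex.norm_mul_exp_arg_mul_I z

lemma measurableEquivRealProd_symm_polarCoord_symm (p : ℝ × ℝ) :
    Complex.measurableEquivRealProd.symm (polarCoord.symm p) = polarMap p := by
  rw [Complex.measurableEquivRealProd_symm_polarCoord_symm_apply, Complex.polarCoord_symm_apply,
    polarMap, Complex.exp_mul_I]
  simp

lemma volume_eq_zero_iff_image_polarMap_comp {Ψ : ℝ × ℝ → ℝ × ℝ} {Ψ' : ℝ × ℝ → ℝ × ℝ →L[ℝ] ℝ × ℝ}
    {D S : Set (ℝ × ℝ)} (hD : MeasurableSet D) (hinj : Set.InjOn (polarMap ∘ Ψ) D)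
    (hΨ : ∀ p ∈ D, HasFDerivAt Ψ (Ψ' p) p) (hdet : ∀ p ∈ D, (Ψ' p).det ≠ 0)
    (hpos : ∀ p ∈ D, (Ψ p).1 ≠ 0) (hS : S ⊆ D) :
    volume S = 0 ↔ volume (polarMap ∘ Ψ '' S) = 0 := by
  have hcomp : polarMap ∘ Ψ = Complex.measurableEquivRealProd.symm ∘ (polarCoord.symm ∘ Ψ) :=
    funext fun p => (measurableEquivRealProd_symm_polarCoord_symm (Ψ p)).symm
  rw [hcomp, Set.image_comp Complex.measurableEquivRealProd.symm,
    MeasurableEquiv.image_symm, Complex.volume_preserving_equiv_real_prod.measure_preimage_equiv]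
  refine measure_eq_zero_iff_image_of_det_ne_zero volume hD ?_
    (fun p hp => (hasFDerivAt_polarCoord_symm (Ψ p)).comp p (hΨ p hp)) (fun p hp => ?_) hS
  · rw [hcomp] at hinj
    exact hinj.of_comp
  · change LinearMap.det ((fderivPolarCoordSymm (Ψ p)).toLinearMap ∘ₗ (Ψ' p).toLinearMap) ≠ 0
    rw [LinearMap.det_comp]
    refine mul_ne_zero ?_ (hdet p hp)
    exact (det_fderivPolarCoordSymm (Ψ p)).trans_ne (hpos p hp)

/-- A fibre-preserving map of the plane has Jacobian equal to its derivative along the fibre. -/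
lemma det_fst_prod (L : ℝ × ℝ →L[ℝ] ℝ) :
    ((ContinuousLinearMap.fst ℝ ℝ ℝ).prod L).det = L (0, 1) := by
  rw [ContinuousLinearMap.det, ← LinearMap.det_toMatrix (Module.Basis.finTwoProd ℝ),
    Matrix.det_fin_two]
  simp [LinearMap.toMatrix_apply]

lemma exp_ofReal_mul_I_eq_iff {a b : ℝ} :
    Complex.exp (a * Complex.I) = Complex.exp (b * Complex.I) ↔
      ∃ n : ℤ, a = b + n * (2 * Real.pi) := by
  rw [Complex.exp_eq_exp_iff_exists_int]
  refine exists_congr fun n => ?_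
  rw [show (b : ℂ) * Complex.I + n * (2 * Real.pi * Complex.I) =
    ((b + n * (2 * Real.pi) : ℝ) : ℂ) * Complex.I by push_cast; ring]
  rw [mul_left_inj' Complex.I_ne_zero, Complex.ofReal_inj]

lemma map_add_int_mul_two_pi {h : ℝ → ℝ} {c : ℝ}
    (hper : ∀ θ, h (θ + 2 * Real.pi) = h θ + c) (n : ℤ) (θ : ℝ) :
    h (θ + n * (2 * Real.pi)) = h θ + n * c := by
  induction n generalizing θ with
  | zero => simp
  | succ k ih =>
    have := hper (θ + (k : ℤ) * (2 * Real.pi))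
    rw [ih] at this
    push_cast at this ⊢
    rw [add_one_mul, ← add_assoc, this]
    ring
  | pred k ih =>
    have := hper (θ + (-(k : ℤ) - 1 : ℤ) * (2 * Real.pi))
    rw [show θ + (-(k : ℤ) - 1 : ℤ) * (2 * Real.pi) + 2 * Real.pi =
      θ + (-(k : ℤ) : ℤ) * (2 * Real.pi) by push_cast; ring, ih] at this
    push_cast at this ⊢
    linarith

lemma exp_comp_eq_of_exp_eq {h : ℝ → ℝ} (hper : ∀ θ, h (θ + 2 * Real.pi) = h θ + 2 * Real.pi)
    {a b : ℝ} (hab : Complex.exp (a * Complex.I) = Complex.exp (b * Complex.I)) :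
    Complex.exp (h a * Complex.I) = Complex.exp (h b * Complex.I) := by
  obtain ⟨n, rfl⟩ := exp_ofReal_mul_I_eq_iff.1 hab
  exact exp_ofReal_mul_I_eq_iff.2 ⟨n, map_add_int_mul_two_pi hper n b⟩

lemma exp_eq_of_exp_comp_eq {h : ℝ → ℝ} (hmono : StrictMono h)
    (hper : ∀ θ, h (θ + 2 * Real.pi) = h θ + 2 * Real.pi)
    {a b : ℝ} (hab : Complex.exp (h a * Complex.I) = Complex.exp (h b * Complex.I)) :
    Complex.exp (a * Complex.I) = Complex.exp (b * Complex.I) := by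
  obtain ⟨n, hn⟩ := exp_ofReal_mul_I_eq_iff.1 hab
  rw [← map_add_int_mul_two_pi hper] at hn
  exact exp_ofReal_mul_I_eq_iff.2 ⟨n, hmono.injective hn⟩

lemma exists_exp_comp_eq {h : ℝ → ℝ} (hcont : Continuous h)
    (hper : ∀ θ, h (θ + 2 * Real.pi) = h θ + 2 * Real.pi) (α : ℝ) :
    ∃ θ, Complex.exp (h θ * Complex.I) = Complex.exp (α * Complex.I) := by
  have hmem := toIcoMod_mem_Ico Real.two_pi_pos (h 0) α
  rw [← hper] at hmem
  obtain ⟨θ, -, hθ⟩ := intermediate_value_Ico (f := h) (by linarith [Real.pi_pos])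
    hcont.continuousOn hmem
  refine ⟨θ, (exp_ofReal_mul_I_eq_iff.2 ⟨toIcoDiv Real.two_pi_pos (h 0) α, ?_⟩).symm⟩
  rw [hθ, ← zsmul_eq_mul, toIcoMod_add_toIcoDiv_zsmul]

lemma injOn_polarMap : Set.InjOn polarMap (Set.Ioo 0 1 ×ˢ Set.Ioc (-Real.pi) Real.pi) := by
  rintro ⟨r, a⟩ ⟨hr, ha⟩ ⟨s, b⟩ ⟨hs, hb⟩ hab
  have hrs := congrArg norm hab
  rw [norm_polarMap hr.1.le, norm_polarMap hs.1.le] at hrs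
  have harg := congrArg Complex.arg hab
  unfold polarMap at harg
  rw [Complex.exp_mul_I, Complex.exp_mul_I, Complex.arg_mul_cos_add_sin_mul_I hr.1 ha,
    Complex.arg_mul_cos_add_sin_mul_I hs.1 hb] at harg
  exact Prod.ext hrs harg

section IncreasingLift

variable {f : ℂ → ℂ} {g : ℝ → ℝ}

lemma radExt_polarMap (hg : Continuous g) (hper : ∀ θ, g (θ + 2 * Real.pi) = g θ + 2 * Real.pi)
    (hlift : ∀ θ : ℝ, f (Complex.exp (θ * Complex.I)) = Complex.exp (g θ * Complex.I))
    {p : ℝ × ℝ} (hp0 : 0 ≤ p.1) (hp1 : p.1 ≤ 1) :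
    radExt f g (polarMap p) = polarMap (p.1, mollify g (1 - p.1) p.2) := by
  rw [radExt, norm_polarMap hp0]
  rcases hp1.eq_or_lt with h1 | h1
  · simp [h1, polarMap, hlift, mollify_zero]
  · rw [if_neg h1.ne, bumpConv_eq_mollify _ (sub_pos.2 h1)]
    rcases hp0.eq_or_lt with h0 | h0
    · simp [← h0, polarMap]
    · unfold polarMap
      congr 1
      refine exp_comp_eq_of_exp_eq (mollify_add_two_pi hg hper _) ?_
      have h := Complex.norm_mul_exp_arg_mul_I (polarMap p)
      rw [norm_polarMap hp0] at h
      exact mul_left_cancel₀ (Complex.ofReal_ne_zero.2 h0.ne') h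

lemma radExt_eq (hg : Continuous g) (hper : ∀ θ, g (θ + 2 * Real.pi) = g θ + 2 * Real.pi)
    (hlift : ∀ θ : ℝ, f (Complex.exp (θ * Complex.I)) = Complex.exp (g θ * Complex.I))
    {z : ℂ} (hz : ‖z‖ ≤ 1) :
    radExt f g z = polarMap (‖z‖, mollify g (1 - ‖z‖) (Complex.arg z)) := by
  conv_lhs => rw [← polarMap_norm_arg z]
  exact radExt_polarMap hg hper hlift (norm_nonneg z) hz

lemma norm_radExt (hg : Continuous g) (hper : ∀ θ, g (θ + 2 * Real.pi) = g θ + 2 * Real.pi)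
    (hlift : ∀ θ : ℝ, f (Complex.exp (θ * Complex.I)) = Complex.exp (g θ * Complex.I))
    {z : ℂ} (hz : ‖z‖ ≤ 1) : ‖radExt f g z‖ = ‖z‖ := by
  rw [radExt_eq hg hper hlift hz, norm_polarMap (norm_nonneg z)]

lemma mem_unitDisc {z : ℂ} : z ∈ unitDisc ↔ ‖z‖ ≤ 1 := mem_closedBall_zero_iff

lemma continuousOn_radExt (hg : Continuous g)
    (hper : ∀ θ, g (θ + 2 * Real.pi) = g θ + 2 * Real.pi)
    (hlift : ∀ θ : ℝ, f (Complex.exp (θ * Complex.I)) = Complex.exp (g θ * Complex.I)) :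
    ContinuousOn (radExt f g) unitDisc := by
  have hmol := continuous_mollify hg
  have hK : IsCompact (Set.Icc (0 : ℝ) 1 ×ˢ Set.Icc (-Real.pi) Real.pi) :=
    isCompact_Icc.prod isCompact_Icc
  have hF : Continuous fun p : ℝ × ℝ => polarMap (p.1, mollify g (1 - p.1) p.2) :=
    continuous_polarMap.comp (continuous_fst.prodMk
      (hmol.comp ((continuous_const.sub continuous_fst).prodMk continuous_snd)))
  refine continuousOn_iff_isClosed.2 fun t ht => ⟨polarMap '' (Set.Icc (0 : ℝ) 1 ×ˢ
    Set.Icc (-Real.pi) Real.pi ∩ (fun p => polarMap (p.1, mollify g (1 - p.1) p.2)) ⁻¹' t),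
    ((hK.inter_right (ht.preimage hF)).image continuous_polarMap).isClosed, ?_⟩
  ext z
  constructor
  · rintro ⟨hzt, hz⟩
    have hz' := mem_unitDisc.1 hz
    refine ⟨⟨(‖z‖, Complex.arg z), ⟨⟨⟨norm_nonneg z, hz'⟩, (Complex.neg_pi_lt_arg z).le,
      Complex.arg_le_pi z⟩, ?_⟩, polarMap_norm_arg z⟩, hz⟩
    rwa [Set.mem_preimage, radExt_eq hg hper hlift hz'] at hzt
  · rintro ⟨⟨p, ⟨hp, hpt⟩, rfl⟩, hz⟩
    refine ⟨?_, hz⟩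
    rwa [Set.mem_preimage, radExt_polarMap hg hper hlift hp.1.1 hp.1.2]

lemma bijOn_radExt (hg : Continuous g) (hmono : StrictMono g)
    (hper : ∀ θ, g (θ + 2 * Real.pi) = g θ + 2 * Real.pi)
    (hlift : ∀ θ : ℝ, f (Complex.exp (θ * Complex.I)) = Complex.exp (g θ * Complex.I)) :
    Set.BijOn (radExt f g) unitDisc unitDisc := by
  refine ⟨fun z hz => ?_, fun z hz w hw hzw => ?_, fun w hw => ?_⟩
  · rw [mem_unitDisc] at hz ⊢
    rwa [norm_radExt hg hper hlift hz]
  · rw [mem_unitDisc] at hz hw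
    have hnorm : ‖z‖ = ‖w‖ := by
      rw [← norm_radExt hg hper hlift hz, hzw, norm_radExt hg hper hlift hw]
    rcases eq_or_ne w 0 with rfl | hw0
    · simpa using hnorm
    rw [radExt_eq hg hper hlift hz, radExt_eq hg hper hlift hw, hnorm] at hzw
    have h := exp_eq_of_exp_comp_eq (strictMono_mollify hg hmono _)
      (mollify_add_two_pi hg hper _)
      (mul_left_cancel₀ (Complex.ofReal_ne_zero.2 (norm_ne_zero_iff.2 hw0)) hzw)
    rw [← polarMap_norm_arg z, ← polarMap_norm_arg w, hnorm]
    exact congrArg (fun w' => (‖w‖ : ℂ) * w') h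
  · have hw' := mem_unitDisc.1 hw
    have hcont : Continuous (mollify g (1 - ‖w‖)) :=
      (continuous_mollify hg).comp (continuous_const.prodMk continuous_id)
    obtain ⟨θ, hθ⟩ := exists_exp_comp_eq hcont (mollify_add_two_pi hg hper _) (Complex.arg w)
    refine ⟨polarMap (‖w‖, θ), ?_, ?_⟩
    · rwa [mem_unitDisc, norm_polarMap (norm_nonneg w)]
    · rw [radExt_polarMap hg hper hlift (norm_nonneg w) hw']
      conv_rhs => rw [← polarMap_norm_arg w]
      exact congrArg (fun w' => (‖w‖ : ℂ) * w') hθ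

lemma exists_hasFDerivAt_mollify (hg : Continuous g) (hmono : StrictMono g) {p : ℝ × ℝ}
    (hp : p.1 < 1) : ∃ L : ℝ × ℝ →L[ℝ] ℝ × ℝ, L.det ≠ 0 ∧
      HasFDerivAt (fun q : ℝ × ℝ => (q.1, mollify g (1 - q.1) q.2)) L p := by
  have hε : 0 < 1 - p.1 := sub_pos.2 hp
  have hdiff : DifferentiableAt ℝ (fun q : ℝ × ℝ => bumpConv (1 - q.1) g q.2) p :=
    (differentiableAt_bumpConv hg (p := (1 - p.1, p.2)) hε).comp p
      (f := fun q : ℝ × ℝ => (1 - q.1, q.2)) (by fun_prop)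
  have hev : (fun q : ℝ × ℝ => mollify g (1 - q.1) q.2) =ᶠ[nhds p]
      fun q => bumpConv (1 - q.1) g q.2 := by
    filter_upwards [(isOpen_lt continuous_fst continuous_const).mem_nhds hp] with q hq
    exact (bumpConv_eq_mollify g (sub_pos.2 hq) q.2).symm
  have hL := hdiff.hasFDerivAt
  set L := fderiv ℝ (fun q : ℝ × ℝ => bumpConv (1 - q.1) g q.2) p
  obtain ⟨d, hd, hd'⟩ := exists_hasDerivAt_bumpConv_pos hg hmono hε p.2
  have hcurve : HasDerivAt (fun θ : ℝ => (p.1, θ)) (0, 1) p.2 :=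
    (hasDerivAt_const _ _).prodMk (hasDerivAt_id _)
  have hLd : L (0, 1) = d := by
    have h := HasFDerivAt.comp_hasDerivAt (f := fun θ : ℝ => (p.1, θ)) p.2 hL hcurve
    exact h.unique hd'
  refine ⟨(ContinuousLinearMap.fst ℝ ℝ ℝ).prod L, ?_,
    hasFDerivAt_fst.prodMk (hL.congr_of_eventuallyEq hev)⟩
  rw [det_fst_prod, hLd]
  exact hd.ne'

lemma volume_eq_zero_iff_image_radExt_of_subset_annulus (hg : Continuous g) (hmono : StrictMono g)
    (hper : ∀ θ, g (θ + 2 * Real.pi) = g θ + 2 * Real.pi)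
    (hlift : ∀ θ : ℝ, f (Complex.exp (θ * Complex.I)) = Complex.exp (g θ * Complex.I))
    {A : Set ℂ} (hA : ∀ z ∈ A, 0 < ‖z‖ ∧ ‖z‖ < 1) :
    volume A = 0 ↔ volume (radExt f g '' A) = 0 := by
  set D : Set (ℝ × ℝ) := Set.Ioo 0 1 ×ˢ Set.Ioc (-Real.pi) Real.pi
  have hD : MeasurableSet D := measurableSet_Ioo.prod measurableSet_Ioc
  have hDdisc : Set.MapsTo polarMap D unitDisc := fun p hp =>
    mem_unitDisc.2 ((norm_polarMap hp.1.1.le).trans_le hp.1.2.le)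
  set Ψ : ℝ × ℝ → ℝ × ℝ := fun q => (q.1, mollify g (1 - q.1) q.2)
  have hΨ : Set.EqOn (radExt f g ∘ polarMap) (polarMap ∘ Ψ) D := fun p hp =>
    radExt_polarMap hg hper hlift hp.1.1.le hp.1.2.le
  have hS : D ∩ polarMap ⁻¹' A ⊆ D := Set.inter_subset_left
  have himage : polarMap '' (D ∩ polarMap ⁻¹' A) = A := by
    refine (Set.image_subset_iff.2 Set.inter_subset_right).antisymm fun z hz => ?_
    exact ⟨(‖z‖, Complex.arg z), ⟨⟨hA z hz, Complex.arg_mem_Ioc z⟩,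
      by rwa [Set.mem_preimage, polarMap_norm_arg]⟩, polarMap_norm_arg z⟩
  have hinj : Set.InjOn (polarMap ∘ Ψ) D :=
    (hΨ.injOn_iff).1 ((bijOn_radExt hg hmono hper hlift).injOn.comp injOn_polarMap hDdisc)
  choose! Ψ' hdet hderiv using fun (p : ℝ × ℝ) (hp : p ∈ D) =>
    exists_hasFDerivAt_mollify hg hmono hp.1.2
  have h1 := volume_eq_zero_iff_image_polarMap_comp (Ψ := id)
    (Ψ' := fun _ => ContinuousLinearMap.id ℝ (ℝ × ℝ)) hD injOn_polarMap
    (fun p _ => hasFDerivAt_id p) (fun p _ => by simp [ContinuousLinearMap.det])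
    (fun p hp => hp.1.1.ne') hS
  have h2 := volume_eq_zero_iff_image_polarMap_comp hD hinj hderiv hdet
    (fun p hp => hp.1.1.ne') hS
  rw [← (hΨ.mono hS).image_eq, Set.image_comp, himage] at h2
  rw [Function.comp_id, himage] at h1
  exact h1.symm.trans h2

lemma volume_eq_zero_iff_image_radExt (hg : Continuous g) (hmono : StrictMono g)
    (hper : ∀ θ, g (θ + 2 * Real.pi) = g θ + 2 * Real.pi)
    (hlift : ∀ θ : ℝ, f (Complex.exp (θ * Complex.I)) = Complex.exp (g θ * Complex.I))
    {A : Set ℂ} (hA : A ⊆ unitDisc) :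
    volume A = 0 ↔ volume (radExt f g '' A) = 0 := by
  set N : Set ℂ := {0} ∪ sphere 0 1
  have hN : volume N = 0 := measure_union_null (by simp) (Measure.addHaar_sphere _ _ _)
  have hsplit : A \ N ∪ A ∩ N = A := Set.sdiff_union_inter A N
  have hmaps : radExt f g '' (A ∩ N) ⊆ N := by
    rintro _ ⟨z, ⟨hzA, hzN⟩, rfl⟩
    have hnorm := norm_radExt hg hper hlift (mem_unitDisc.1 (hA hzA))
    simp only [N, Set.mem_union, Set.mem_singleton_iff, mem_sphere_zero_iff_norm] at hzN ⊢
    rwa [← norm_eq_zero, hnorm, norm_eq_zero]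
  rw [← hsplit, Set.image_union, measure_union_null_iff, measure_union_null_iff,
    and_iff_left (measure_mono_null Set.inter_subset_right hN),
    and_iff_left (measure_mono_null hmaps hN)]
  refine volume_eq_zero_iff_image_radExt_of_subset_annulus hg hmono hper hlift fun z hz => ?_
  have hz' := hz.2
  simp only [N, Set.mem_union, Set.mem_singleton_iff, mem_sphere_zero_iff_norm, not_or] at hz'
  exact ⟨norm_pos_iff.2 hz'.1, (mem_unitDisc.1 (hA hz.1)).lt_of_ne hz'.2⟩

end IncreasingLift

lemma exp_ofReal_mul_I_mem_unitCircle (θ : ℝ) : Complex.exp (θ * Complex.I) ∈ unitCircle := by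
  rw [unitCircle, mem_sphere_zero_iff_norm, Complex.norm_exp_ofReal_mul_I]

/-- A continuous lift of a circle homeomorphism is strictly monotone of degree `±1`. -/
lemma lift_strictMono_or_strictAnti {f : ℂ → ℂ} {g : ℝ → ℝ} (hinj : Set.InjOn f unitCircle)
    (hg : Continuous g) (hg0 : g 0 = 0)
    (hlift : ∀ θ : ℝ, f (Complex.exp (θ * Complex.I)) = Complex.exp (g θ * Complex.I)) :
    (StrictMono g ∧ ∀ θ, g (θ + 2 * Real.pi) = g θ + 2 * Real.pi) ∨
      (StrictAnti g ∧ ∀ θ, g (θ + 2 * Real.pi) = g θ - 2 * Real.pi) := by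
  have hpi := Real.pi_pos
  have hker : ∀ a b : ℝ, (∃ n : ℤ, g a = g b + n * (2 * Real.pi)) →
      ∃ n : ℤ, a = b + n * (2 * Real.pi) := by
    intro a b h
    rw [← exp_ofReal_mul_I_eq_iff, ← hlift, ← hlift] at h
    exact exp_ofReal_mul_I_eq_iff.1
      (hinj (exp_ofReal_mul_I_mem_unitCircle a) (exp_ofReal_mul_I_mem_unitCircle b) h)
  have hmem : ∀ θ : ℝ, ∃ n : ℤ, g (θ + 2 * Real.pi) = g θ + n * (2 * Real.pi) := by
    intro θ
    rw [← exp_ofReal_mul_I_eq_iff, ← hlift, ← hlift]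
    congr 1
    exact exp_ofReal_mul_I_eq_iff.2 ⟨1, by simp⟩
  choose m hm using hmem
  have hmcont : Continuous m := by
    have hm' : (fun θ => (m θ : ℝ)) = fun θ => (g (θ + 2 * Real.pi) - g θ) / (2 * Real.pi) := by
      ext θ
      rw [hm, add_sub_cancel_left, mul_div_cancel_right₀ _ Real.two_pi_pos.ne']
    refine Int.isClosedEmbedding_coe_real.isInducing.continuous_iff.2 ?_
    change Continuous fun θ => (m θ : ℝ)
    rw [hm']
    fun_prop
  obtain ⟨k, hk⟩ : ∃ k : ℤ, ∀ θ, g (θ + 2 * Real.pi) = g θ + k * (2 * Real.pi) :=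
    ⟨m 0, fun θ => by rw [hm, PreconnectedSpace.constant inferInstance hmcont (x := θ) (y := 0)]⟩
  have hk2 : g (2 * Real.pi) = k * (2 * Real.pi) := by simpa [hg0] using hk 0
  -- a value of `g` in `2πℤ` cannot be taken strictly between `0` and `2π`
  have hnot : ∀ n : ℤ, ∀ t ∈ Set.Ioo 0 (2 * Real.pi), g t ≠ n * (2 * Real.pi) := by
    intro n t ht hgt
    obtain ⟨j, hj⟩ := hker t 0 ⟨n, by rw [hgt, hg0, zero_add]⟩
    rw [zero_add] at hj
    rw [hj] at ht
    have h0 : (0 : ℝ) < j := by nlinarith [ht.1]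
    have h1 : (j : ℝ) < 1 := by nlinarith [ht.2]
    norm_cast at h0 h1
    omega
  have hk0 : k ≠ 0 := by
    rintro rfl
    have hd : Continuous fun θ => g (θ + Real.pi) - g θ := by fun_prop
    have hend : g (Real.pi + Real.pi) - g Real.pi = -(g (0 + Real.pi) - g 0) := by
      rw [← two_mul, hk2, zero_add, hg0]
      simp
    obtain ⟨t, ht⟩ : ∃ t, g (t + Real.pi) - g t = 0 := by
      rcases le_total (g (0 + Real.pi) - g 0) 0 with h | h
      · exact mem_range_of_exists_le_of_exists_ge hd ⟨0, h⟩ ⟨Real.pi, by linarith⟩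
      · exact mem_range_of_exists_le_of_exists_ge hd ⟨Real.pi, by linarith⟩ ⟨0, h⟩
    obtain ⟨j, hj⟩ := hker (t + Real.pi) t ⟨0, by simpa using sub_eq_zero.1 ht⟩
    have : (2 * j : ℝ) = 1 := by
      have h : Real.pi * (2 * j - 1) = 0 := by linarith
      linarith [(mul_eq_zero.1 h).resolve_left hpi.ne']
    norm_cast at this
    omega
  have hginj : Function.Injective g := by
    intro a b hab
    obtain ⟨j, rfl⟩ := hker a b ⟨0, by simpa using hab⟩
    rw [map_add_int_mul_two_pi hk, add_eq_left] at hab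
    have hj : j = 0 := by simpa [hk0, hpi.ne'] using hab
    simp [hj]
  rcases hg.strictMono_of_inj hginj with hmono | hanti
  · left
    have hpos : 0 < k := by
      have := hmono Real.two_pi_pos
      rw [hg0, hk2] at this
      exact_mod_cast pos_of_mul_pos_left this Real.two_pi_pos.le
    have hk1 : k = 1 := by
      by_contra hne
      have h2 : (2 : ℝ) ≤ k := by exact_mod_cast (by omega : (2 : ℤ) ≤ k)
      obtain ⟨t, ht, hgt⟩ := intermediate_value_Ioo Real.two_pi_pos.le hg.continuousOn
        (show 2 * Real.pi ∈ Set.Ioo (g 0) (g (2 * Real.pi)) by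
          rw [hg0, hk2]; constructor <;> nlinarith)
      exact hnot 1 t ht (by simpa using hgt)
    exact ⟨hmono, fun θ => by rw [hk, hk1, Int.cast_one, one_mul]⟩
  · right
    have hneg : k < 0 := by
      have := hanti Real.two_pi_pos
      rw [hg0, hk2] at this
      have h : (k : ℝ) < 0 := by nlinarith
      exact_mod_cast h
    have hk1 : k = -1 := by
      by_contra hne
      have h2 : (k : ℝ) ≤ -2 := by exact_mod_cast (by omega : k ≤ (-2 : ℤ))
      obtain ⟨t, ht, hgt⟩ := intermediate_value_Ioo' Real.two_pi_pos.le hg.continuousOn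
        (show -(2 * Real.pi) ∈ Set.Ioo (g (2 * Real.pi)) (g 0) by
          rw [hg0, hk2]; constructor <;> nlinarith)
      exact hnot (-1) t ht (by simpa using hgt)
    exact ⟨hanti, fun θ => by rw [hk, hk1]; push_cast; ring⟩

lemma radExt_conj (f : ℂ → ℂ) (g : ℝ → ℝ) (z : ℂ) :
    radExt (fun z => Complex.conjLIE (f z)) (-g) z = Complex.conjLIE (radExt f g z) := by
  have hconv : ∀ ε θ, bumpConv ε (-g) θ = -bumpConv ε g θ := fun ε θ => by
    simp [bumpConv, integral_neg]
  unfold radExt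
  split_ifs
  · rfl
  · rw [Complex.conjLIE_apply, map_mul, Complex.conj_ofReal, ← Complex.exp_conj, map_mul,
      Complex.conj_I, Complex.conj_ofReal, hconv]
    push_cast
    ring_nf

/-- The radial mollified extension of a circle homeomorphism fixing `1` is a homeomorphism of
the closed unit disc onto itself (a continuous bijection of the compact disc onto itself), and
it preserves nullity: a subset `A` of the disc has Lebesgue measure zero iff its image does. -/
theorem radExt_homeo_null_preserving (f : ℂ → ℂ) (hf : CircleHomeo f) (h1 : f 1 = 1)
    (g : ℝ → ℝ) (hg : IsLift f g) :
    ContinuousOn (radExt f g) unitDisc ∧ Set.BijOn (radExt f g) unitDisc unitDisc ∧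
      ∀ A : Set ℂ, A ⊆ unitDisc → (volume A = 0 ↔ volume (radExt f g '' A) = 0) := by
  obtain ⟨hgc, hg0, hlift⟩ := hg
  rcases lift_strictMono_or_strictAnti hf.2.injOn hgc hg0 hlift with ⟨hmono, hper⟩ | ⟨hanti, hper⟩
  · exact ⟨continuousOn_radExt hgc hper hlift, bijOn_radExt hgc hmono hper hlift,
      fun A hA => volume_eq_zero_iff_image_radExt hgc hmono hper hlift hA⟩
  have hper' : ∀ θ, (-g) (θ + 2 * Real.pi) = (-g) θ + 2 * Real.pi := fun θ => by
    rw [Pi.neg_apply, Pi.neg_apply, hper]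
    ring
  have hlift' : ∀ θ : ℝ, Complex.conjLIE (f (Complex.exp (θ * Complex.I))) =
      Complex.exp (((-g) θ : ℝ) * Complex.I) := fun θ => by
    rw [hlift, Complex.conjLIE_apply, ← Complex.exp_conj]
    simp
  have hconj : radExt f g =
      Complex.conjLIE ∘ radExt (fun z => Complex.conjLIE (f z)) (-g) := by
    ext z
    rw [Function.comp_apply, radExt_conj, Complex.conjLIE_apply, Complex.conjLIE_apply,
      Complex.conj_conj]
  have hdisc : Set.BijOn Complex.conjLIE unitDisc unitDisc := by
    have h := Complex.conjLIE.injective.injOn.bijOn_image (s := unitDisc)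
    rwa [unitDisc, Complex.conjLIE.image_closedBall, map_zero] at h
  rw [hconj]
  refine ⟨Complex.conjLIE.continuous.comp_continuousOn (continuousOn_radExt hgc.neg hper' hlift'),
    hdisc.comp (bijOn_radExt hgc.neg hanti.neg hper' hlift'), fun A hA => ?_⟩
  rw [volume_eq_zero_iff_image_radExt (f := fun z => Complex.conjLIE (f z)) hgc.neg hanti.neg
    hper' hlift' hA, Set.image_comp]
  rw [← Complex.conjLIE.measurePreserving.measure_preimage_emb
    Complex.conjLIE.toHomeomorph.measurableEmbedding (Complex.conjLIE '' _),
    Set.preimage_image_eq _ Complex.conjLIE.injective]
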